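/- For every n ≥ 6 and for each index i ∈ {1, 2}: ZCi(PC(1, 2^{n−4}, 1)) > ZCi(PC(2, 1^{n−4}, 2)), i.e., both the first and the second Zagreb connection index of the chain whose links are 1, then n−4 twos, then 1, strictly exceed those of the chain whose links are 2, then n−4 ones, then 2. -/

import Mathlib

noncomputable section
open scoped Classical
open Finset

/-- Taxicab (L¹) distance between two lattice points. -/
def taxicab (u v : ℤ × ℤ) : ℕ := (u.1 - v.1).natAbs + (u.2 - v.2).natAbs

/-- `c 0, …, c (n-1)` are the lower-left corners of the `n` unit squares of a
polyomino chain: the cells are pairwise distinct and two cells share a common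
edge (i.e. their lower-left corners are at taxicab distance 1) iff they are
consecutive in the chain, so that the centers of the squares form a path. -/
def IsPolyominoChain (n : ℕ) (c : ℕ → ℤ × ℤ) : Prop :=
  (∀ i j, i < n → j < n → c i = c j → i = j) ∧
  (∀ i j, i < n → j < n → (taxicab (c i) (c j) = 1 ↔ (i = j + 1 ∨ j = i + 1)))

/-- `v` is a corner of the unit square with lower-left corner `s`. -/
def IsSquareCorner (s v : ℤ × ℤ) : Prop :=
  v = s ∨ v = s + (1, 0) ∨ v = s + (0, 1) ∨ v = s + (1, 1)

/-- The vertex set of the graph of a polyomino chain: all corners of its squares. -/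
def corners (n : ℕ) (c : ℕ → ℤ × ℤ) : Finset (ℤ × ℤ) :=
  (Finset.range n).biUnion fun i => {c i, c i + (1, 0), c i + (0, 1), c i + (1, 1)}

/-- The graph of a polyomino chain: vertices are corners of the squares, and
two corners are adjacent iff they are the endpoints of a unit side of one of
the squares of the chain. -/
def chainGraph (n : ℕ) (c : ℕ → ℤ × ℤ) : SimpleGraph (ℤ × ℤ) :=
  SimpleGraph.fromRel fun u v =>
    taxicab u v = 1 ∧ ∃ i < n, IsSquareCorner (c i) u ∧ IsSquareCorner (c i) v

/-- `tau n c v` = number of vertices of the chain graph at graph distance exactly 2 from `v`. -/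
def tau (n : ℕ) (c : ℕ → ℤ × ℤ) (v : ℤ × ℤ) : ℕ :=
  ((corners n c).filter fun u => (chainGraph n c).dist v u = 2).card

/-- First Zagreb connection index `ZC1 = ∑_{v ∈ V} τ_v²`. -/
def ZC1 (n : ℕ) (c : ℕ → ℤ × ℤ) : ℕ := ∑ v ∈ corners n c, tau n c v ^ 2

/-- Second Zagreb connection index `ZC2 = ∑_{uv ∈ E} τ_u · τ_v`
(each edge appears twice in the double sum, whence the division by 2). -/
def ZC2 (n : ℕ) (c : ℕ → ℤ × ℤ) : ℕ :=
  (∑ u ∈ corners n c, ∑ v ∈ corners n c,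
      if (chainGraph n c).Adj u v then tau n c u * tau n c v else 0) / 2

/-- The link `L_k` (for `3 ≤ k ≤ n`) of a polyomino chain: `1` if the `k`-th
square continues the current straight segment, `2` if it is attached at a kink. -/
def link (c : ℕ → ℤ × ℤ) (k : ℕ) : ℕ :=
  if c (k - 1) - c (k - 2) = c (k - 2) - c (k - 3) then 1 else 2

/-- Indicator of a proposition, as an integer. -/
def ind (P : Prop) : ℤ := if P then 1 else 0

/-- The chain `c` with `n` squares has `m` segments, of lengths `l 1, …, l m`:
there are cut positions `2 = k 0 < k 1 < ⋯ < k (m-1) < k m = n+1` such that the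
kink links (links equal to 2) are exactly at positions `k 1, …, k (m-1)`, and the
`j`-th segment has length `l j = k j - k (j-1) + 1`. -/
def HasSegments (n : ℕ) (c : ℕ → ℤ × ℤ) (m : ℕ) (l : ℕ → ℕ) : Prop :=
  ∃ k : ℕ → ℕ, k 0 = 2 ∧ k m = n + 1 ∧
    (∀ j, 1 ≤ j → j ≤ m → k (j - 1) < k j) ∧
    (∀ x, 3 ≤ x → x ≤ n → (link c x = 2 ↔ ∃ j, 1 ≤ j ∧ j ≤ m - 1 ∧ k j = x)) ∧
    (∀ j, 1 ≤ j → j ≤ m → l j = k j - k (j - 1) + 1)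

/-- The chain `c` with `n` squares has link sequence `L_3, …, L_n`. -/
def HasLinks (n : ℕ) (c : ℕ → ℤ × ℤ) (L : ℕ → ℕ) : Prop :=
  ∀ k, 3 ≤ k → k ≤ n → link c k = L k

/-- The linear chain `Li_n` (all links equal to 1). -/
def linCell : ℕ → ℤ × ℤ := fun i => ((i : ℤ), 0)

/-- The zigzag chain `Z_n` (all links equal to 2). -/
def zigCell : ℕ → ℤ × ℤ := fun i => ((((i + 1) / 2 : ℕ) : ℤ), ((i / 2 : ℕ) : ℤ))

set_option linter.unusedSimpArgs false

theorem mem_corners_iff {n : ℕ} {c : ℕ → ℤ × ℤ} {v : ℤ × ℤ} :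
    v ∈ corners n c ↔ ∃ i < n, IsSquareCorner (c i) v := by
  simp [corners, IsSquareCorner]

theorem taxicab_comm (u v : ℤ × ℤ) : taxicab u v = taxicab v u := by
  unfold taxicab; omega

theorem chainGraph_adj_iff {n : ℕ} {c : ℕ → ℤ × ℤ} {u v : ℤ × ℤ} :
    (chainGraph n c).Adj u v ↔
      taxicab u v = 1 ∧ ∃ i < n, IsSquareCorner (c i) u ∧ IsSquareCorner (c i) v := by
  rw [chainGraph, SimpleGraph.fromRel_adj]
  constructor
  · rintro ⟨-, h | ⟨h, i, hi, hv, hu⟩⟩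
    · exact h
    · exact ⟨taxicab_comm u v ▸ h, i, hi, hu, hv⟩
  · intro h
    refine ⟨?_, Or.inl h⟩
    rintro rfl
    simp [taxicab] at h

/-- The chain graph is bipartite, so distance two means distinct with a common neighbour. -/
theorem chainGraph_dist_eq_two_iff {n : ℕ} {c : ℕ → ℤ × ℤ} {u v : ℤ × ℤ} :
    (chainGraph n c).dist u v = 2 ↔
      u ≠ v ∧ ∃ w, (chainGraph n c).Adj u w ∧ (chainGraph n c).Adj w v := by
  constructor
  · intro h
    have hr : (chainGraph n c).Reachable u v := by
      by_contra hr
      rw [SimpleGraph.dist_eq_zero_of_not_reachable hr] at h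
      omega
    refine ⟨fun e => by simp [e] at h, ?_⟩
    obtain ⟨p, hp⟩ := hr.exists_walk_length_eq_dist
    rw [h] at hp
    cases p with
    | nil => simp at hp
    | cons h₁ q =>
      cases q with
      | nil => simp at hp
      | cons h₂ r =>
        have hr0 : r.length = 0 := by simpa using hp
        obtain rfl := SimpleGraph.Walk.eq_of_length_eq_zero hr0
        exact ⟨_, h₁, h₂⟩
  · rintro ⟨hne, w, h₁, h₂⟩
    have hle : (chainGraph n c).dist u v ≤ 2 :=
      SimpleGraph.dist_le (.cons h₁ (.cons h₂ .nil))
    have h0 : (chainGraph n c).dist u v ≠ 0 := fun h0 =>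
      hne (((h₁.reachable.trans h₂.reachable).dist_eq_zero_iff).1 h0)
    have h1 : (chainGraph n c).dist u v ≠ 1 := fun h1 => by
      have h := (chainGraph_adj_iff.1 (SimpleGraph.dist_eq_one_iff_adj.1 h1)).1
      have h₁ := (chainGraph_adj_iff.1 h₁).1
      have h₂ := (chainGraph_adj_iff.1 h₂).1
      unfold taxicab at h h₁ h₂
      omega
    omega

/-- Twice the second Zagreb connection index, as a sum over ordered pairs. -/
def adjSum (n : ℕ) (c : ℕ → ℤ × ℤ) : ℕ :=
  ∑ p ∈ (corners n c ×ˢ corners n c).filter (fun p => (chainGraph n c).Adj p.1 p.2),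
    tau n c p.1 * tau n c p.2

theorem ZC2_eq_adjSum_div_two (n : ℕ) (c : ℕ → ℤ × ℤ) : ZC2 n c = adjSum n c / 2 := by
  rw [ZC2, adjSum, Finset.sum_filter, Finset.sum_product]

/-- A taxicab isometry matching up the cells of two chains preserves both indices. -/
theorem ZC_congr {n : ℕ} {c c' : ℕ → ℤ × ℤ} (Φ : ℤ × ℤ ≃ ℤ × ℤ)
    (hΦ : ∀ u v, taxicab (Φ u) (Φ v) = taxicab u v)
    (hc : ∀ i < n, ∀ v, IsSquareCorner (c' i) (Φ v) ↔ IsSquareCorner (c i) v) :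
    ZC1 n c' = ZC1 n c ∧ ZC2 n c' = ZC2 n c := by
  have hmem : ∀ v, Φ v ∈ corners n c' ↔ v ∈ corners n c := fun v => by
    simp only [mem_corners_iff]
    exact exists_congr fun i => and_congr_right fun hi => hc i hi v
  have hC : corners n c' = (corners n c).map Φ.toEmbedding := by
    ext v
    obtain ⟨w, rfl⟩ := Φ.surjective v
    simp [hmem]
  have hadj : ∀ u v, (chainGraph n c').Adj (Φ u) (Φ v) ↔ (chainGraph n c).Adj u v := fun u v => by
    rw [chainGraph_adj_iff, chainGraph_adj_iff, hΦ]
    refine and_congr_right fun _ => exists_congr fun i => and_congr_right fun hi => ?_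
    rw [hc i hi, hc i hi]
  have hdist : ∀ u v, (chainGraph n c').dist (Φ u) (Φ v) = 2 ↔ (chainGraph n c).dist u v = 2 := by
    intro u v
    rw [chainGraph_dist_eq_two_iff, chainGraph_dist_eq_two_iff, Φ.injective.ne_iff,
      ← Φ.exists_congr_right]
    simp only [hadj]
  have htau : ∀ v, tau n c' (Φ v) = tau n c v := fun v => by
    simp [tau, hC, Finset.filter_map, hdist]
  constructor
  · simp [ZC1, hC, htau]
  · simp [ZC2, hC, htau, hadj]

theorem le_tau {n : ℕ} {c : ℕ → ℤ × ℤ} {v : ℤ × ℤ} (l : List (ℤ × ℤ)) (hl : l.Nodup)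
    (h : ∀ z ∈ l, v ≠ z ∧ ∃ w, (chainGraph n c).Adj v w ∧ (chainGraph n c).Adj w z) :
    l.length ≤ tau n c v := by
  rw [← List.toFinset_card_of_nodup hl, tau]
  refine Finset.card_le_card fun z hz => ?_
  have hz := h z (List.mem_toFinset.1 hz)
  refine Finset.mem_filter.2 ⟨?_, chainGraph_dist_eq_two_iff.2 hz⟩
  obtain ⟨-, w, -, hw⟩ := hz
  obtain ⟨-, i, hi, -, hz⟩ := chainGraph_adj_iff.1 hw
  exact mem_corners_iff.2 ⟨i, hi, hz⟩

theorem tau_le {n : ℕ} {c : ℕ → ℤ × ℤ} {v : ℤ × ℤ} (l : List (ℤ × ℤ))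
    (h : ∀ z w, v ≠ z → (chainGraph n c).Adj v w → (chainGraph n c).Adj w z → z ∈ l) :
    tau n c v ≤ l.length := by
  refine le_trans (Finset.card_le_card fun z hz => ?_) (List.toFinset_card_le l)
  obtain ⟨hne, w, h₁, h₂⟩ := chainGraph_dist_eq_two_iff.1 (Finset.mem_filter.1 hz).2
  exact List.mem_toFinset.2 (h z w hne h₁ h₂)

theorem sum_le_list_sum {α : Type*} {s : Finset α} {l : List α} (f : α → ℕ)
    (h : ∀ a ∈ s, a ∈ l) : ∑ a ∈ s, f a ≤ (l.map f).sum := by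
  induction l generalizing s with
  | nil => simp [Finset.eq_empty_of_forall_notMem (fun a ha => by simpa using h a ha)]
  | cons b l ih =>
    have hs : s ⊆ insert b (s.erase b) := by
      intro a ha; by_cases hab : a = b <;> simp [hab, ha]
    have := ih (s := s.erase b) fun a ha => by
      rcases List.mem_cons.1 (h a (Finset.mem_of_mem_erase ha)) with e | e
      · exact absurd e (Finset.ne_of_mem_erase ha)
      · exact e
    calc ∑ a ∈ s, f a ≤ ∑ a ∈ insert b (s.erase b), f a := Finset.sum_le_sum_of_subset hs
      _ = f b + ∑ a ∈ s.erase b, f a := Finset.sum_insert (Finset.notMem_erase b s)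
      _ ≤ _ := by simpa using this

theorem list_sum_le_sum {α : Type*} {s : Finset α} {l : List α} (f : α → ℕ) (hl : l.Nodup)
    (h : ∀ a ∈ l, a ∈ s) : (l.map f).sum ≤ ∑ a ∈ s, f a := by
  rw [← List.sum_toFinset f hl]
  exact Finset.sum_le_sum_of_subset fun a ha => h a (List.mem_toFinset.1 ha)

theorem list_range_map_sum (f : ℕ → ℕ) (n : ℕ) :
    ((List.range n).map f).sum = ∑ i ∈ Finset.range n, f i := rfl

/-- A sum whose terms are constant away from three terms at each end. -/
theorem sum_range_eq_of_middle (g : ℕ → ℕ) (k q : ℕ) (h : ∀ x, 3 ≤ x → x < k + 3 → g x = q) :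
    ∑ x ∈ Finset.range (k + 6), g x =
      g 0 + g 1 + g 2 + k * q + g (k + 3) + g (k + 4) + g (k + 5) := by
  have hk : ∑ x ∈ Finset.range k, g (x + 3) = k * q := by
    rw [Finset.sum_congr rfl fun x hx => h (x + 3) (by omega)
      (by have := Finset.mem_range.1 hx; omega)]
    simp
  rw [Finset.sum_range_succ, Finset.sum_range_succ, Finset.sum_range_succ,
    Finset.sum_range_succ', Finset.sum_range_succ', Finset.sum_range_succ']
  simp only [add_assoc] at hk ⊢
  simp only [Nat.reduceAdd, hk]
  ring

/-- The chain with links `2, 1^(k+2), 2`: a row of cells with one cell above its left end and one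
cell above (`s = 1`) or below (`s = -1`) its right end. -/
def rowCell (k : ℕ) (s : ℤ) (i : ℕ) : ℤ × ℤ :=
  if i = 0 then (0, 1) else if i = k + 5 then ((k : ℤ) + 3, s) else ((i : ℤ) - 1, 0)

/-- The corners of the cells `rowCell k s 0, …, rowCell k s (k + 5)`. -/
def IsRowCorner (k : ℕ) (s : ℤ) (v : ℤ × ℤ) : Prop :=
  (0 ≤ v.1 ∧ v.1 ≤ k + 4 ∧ 0 ≤ v.2 ∧ v.2 ≤ 1) ∨ (0 ≤ v.1 ∧ v.1 ≤ 1 ∧ v.2 = 2) ∨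
    ((k : ℤ) + 3 ≤ v.1 ∧ v.1 ≤ k + 4 ∧ s ≤ v.2 ∧ v.2 ≤ s + 1)

theorem IsRowCorner.of_isSquareCorner {k : ℕ} {s : ℤ} {i : ℕ} {v : ℤ × ℤ} (hi : i < k + 6)
    (h : IsSquareCorner (rowCell k s i) v) : IsRowCorner k s v := by
  obtain ⟨a, b⟩ := v
  unfold rowCell at h
  unfold IsRowCorner
  split_ifs at h with h₁ h₂ <;> simp only [IsSquareCorner, Prod.ext_iff, Prod.mk_add_mk] at h ⊢ <;>
    omega

theorem taxicab_eq_one {x y z w : ℤ} (h : taxicab (x, y) (z, w) = 1) :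
    ∃ d : ℤ, (d = 1 ∨ d = -1) ∧ (z = x + d ∧ w = y ∨ z = x ∧ w = y + d) := by
  simp only [taxicab] at h
  by_cases hx : z = x
  · exact ⟨w - y, by omega, by omega⟩
  · exact ⟨z - x, by omega, by omega⟩

/-- Only the eight lattice points at taxicab distance two can contribute to `tau`. -/
theorem tau_rowCell_le {k : ℕ} {s x y : ℤ} (l : List (ℤ × ℤ))
    (h : ∀ d : ℤ, (d = 1 ∨ d = -1) →
      (IsRowCorner k s (x + d, y) → IsRowCorner k s (x + 2 * d, y) → (x + 2 * d, y) ∈ l) ∧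
      (IsRowCorner k s (x, y + d) → IsRowCorner k s (x, y + 2 * d) → (x, y + 2 * d) ∈ l) ∧
      (IsRowCorner k s (x + d, y) ∨ IsRowCorner k s (x, y + 1) →
        IsRowCorner k s (x + d, y + 1) → (x + d, y + 1) ∈ l) ∧
      (IsRowCorner k s (x + d, y) ∨ IsRowCorner k s (x, y - 1) →
        IsRowCorner k s (x + d, y - 1) → (x + d, y - 1) ∈ l)) :
    tau (k + 6) (rowCell k s) (x, y) ≤ l.length := by
  refine tau_le l fun z w hne h₁ h₂ => ?_
  obtain ⟨h₁, -⟩ := chainGraph_adj_iff.1 h₁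
  obtain ⟨h₂, i, hi, hw, hz⟩ := chainGraph_adj_iff.1 h₂
  have hw := IsRowCorner.of_isSquareCorner hi hw
  have hz := IsRowCorner.of_isSquareCorner hi hz
  obtain ⟨z₁, z₂⟩ := z
  obtain ⟨w₁, w₂⟩ := w
  simp only [ne_eq, Prod.ext_iff] at hne
  obtain ⟨d, hd, ⟨rfl, rfl⟩ | ⟨rfl, rfl⟩⟩ := taxicab_eq_one h₁ <;>
    obtain ⟨e, he, ⟨rfl, rfl⟩ | ⟨rfl, rfl⟩⟩ := taxicab_eq_one h₂
  · obtain rfl : d = e := by omega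
    rw [add_assoc, ← two_mul] at hz ⊢
    exact (h d hd).1 hw hz
  · rcases he with rfl | rfl
    exacts [(h d hd).2.2.1 (.inl hw) hz, (h d hd).2.2.2 (.inl hw) hz]
  · rcases hd with rfl | rfl
    exacts [(h e he).2.2.1 (.inr hw) hz, (h e he).2.2.2 (.inr hw) hz]
  · obtain rfl : d = e := by omega
    rw [add_assoc, ← two_mul] at hz ⊢
    exact (h d hd).2.1 hw hz

/-- Connection numbers along the upper side of the row. -/
def rowTop (k : ℕ) (s : ℤ) (x : ℕ) : ℕ :=
  if x = 0 ∨ x = k + 4 then 3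
  else 4 + (if x = 2 then 1 else 0) + (if x = k + 2 ∧ s = 1 then 1 else 0)

/-- Connection numbers along the lower side of the row. -/
def rowBot (k : ℕ) (s : ℤ) (x : ℕ) : ℕ :=
  if x = 0 ∨ x = k + 4 then 3 else 4 + (if x = k + 2 ∧ s = -1 then 1 else 0)

theorem tau_rowTop_le {k x : ℕ} {s : ℤ} (hs : s = 1 ∨ s = -1) (hx : x < k + 5) :
    tau (k + 6) (rowCell k s) ((x : ℤ), 1) ≤ rowTop k s x := by
  obtain rfl | rfl | rfl | rfl | h : x = 0 ∨ x = 1 ∨ x = k + 3 ∨ x = k + 4 ∨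
      (2 ≤ x ∧ x ≤ k + 2) := by omega
  · refine (tau_rowCell_le [(2, 1), (1, 0), (1, 2)] ?_).trans ?_
    · rintro d (rfl | rfl) <;>
      simp only [IsRowCorner, List.mem_cons, List.not_mem_nil, Prod.ext_iff, or_false,
        and_true, true_and] <;>
      refine ⟨?_, ?_, ?_, ?_⟩ <;> omega
    · simp only [rowTop, List.length_cons, List.length_nil]
      split_ifs <;> omega
  · refine (tau_rowCell_le [(3, 1), (0, 0), (2, 0), (0, 2)] ?_).trans ?_
    · rintro d (rfl | rfl) <;>
      simp only [IsRowCorner, List.mem_cons, List.not_mem_nil, Prod.ext_iff, or_false,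
        and_true, true_and] <;>
      refine ⟨?_, ?_, ?_, ?_⟩ <;> omega
    · simp only [rowTop, List.length_cons, List.length_nil]
      split_ifs <;> first | omega | simp_all
  · rcases hs with rfl | rfl
    · refine (tau_rowCell_le
        [((k : ℤ) + 1, 1), ((k : ℤ) + 2, 0), ((k : ℤ) + 4, 0), ((k : ℤ) + 4, 2)] ?_).trans ?_
      · rintro d (rfl | rfl) <;>
        simp only [IsRowCorner, List.mem_cons, List.not_mem_nil, Prod.ext_iff, or_false,
          and_true, true_and] <;>
        refine ⟨?_, ?_, ?_, ?_⟩ <;> omega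
      · simp only [rowTop, List.length_cons, List.length_nil]
        split_ifs <;> first | omega | simp_all
    · refine (tau_rowCell_le
        [((k : ℤ) + 1, 1), ((k : ℤ) + 2, 0), ((k : ℤ) + 4, 0), ((k : ℤ) + 3, -1)] ?_).trans ?_
      · rintro d (rfl | rfl) <;>
        simp only [IsRowCorner, List.mem_cons, List.not_mem_nil, Prod.ext_iff, or_false,
          and_true, true_and] <;>
        refine ⟨?_, ?_, ?_, ?_⟩ <;> omega
      · simp only [rowTop, List.length_cons, List.length_nil]
        split_ifs <;> first | omega | simp_all
  · rcases hs with rfl | rfl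
    · refine (tau_rowCell_le [((k : ℤ) + 2, 1), ((k : ℤ) + 3, 0), ((k : ℤ) + 3, 2)] ?_).trans ?_
      · rintro d (rfl | rfl) <;>
        simp only [IsRowCorner, List.mem_cons, List.not_mem_nil, Prod.ext_iff, or_false,
          and_true, true_and] <;>
        refine ⟨?_, ?_, ?_, ?_⟩ <;> omega
      · simp only [rowTop, List.length_cons, List.length_nil]
        split_ifs <;> omega
    · refine (tau_rowCell_le [((k : ℤ) + 2, 1), ((k : ℤ) + 3, 0), ((k : ℤ) + 4, -1)] ?_).trans ?_
      · rintro d (rfl | rfl) <;>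
        simp only [IsRowCorner, List.mem_cons, List.not_mem_nil, Prod.ext_iff, or_false,
          and_true, true_and] <;>
        refine ⟨?_, ?_, ?_, ?_⟩ <;> omega
      · simp only [rowTop, List.length_cons, List.length_nil]
        split_ifs <;> omega
  · by_cases h2 : x = 2
    · by_cases hr : x = k + 2 ∧ s = 1
      · refine (tau_rowCell_le
          [((x : ℤ) - 2, 1), ((x : ℤ) + 2, 1), ((x : ℤ) - 1, 0), ((x : ℤ) + 1, 0), (1, 2),
           (3, 2)] ?_).trans ?_
        · rintro d (rfl | rfl) <;>
          simp only [IsRowCorner, List.mem_cons, List.not_mem_nil, Prod.ext_iff, or_false,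
            and_true, true_and] <;>
          refine ⟨?_, ?_, ?_, ?_⟩ <;> omega
        · simp only [rowTop, List.length_cons, List.length_nil]
          split_ifs <;> omega
      · refine (tau_rowCell_le
          [((x : ℤ) - 2, 1), ((x : ℤ) + 2, 1), ((x : ℤ) - 1, 0), ((x : ℤ) + 1, 0),
           (1, 2)] ?_).trans ?_
        · rintro d (rfl | rfl) <;>
          simp only [IsRowCorner, List.mem_cons, List.not_mem_nil, Prod.ext_iff, or_false,
            and_true, true_and] <;>
          refine ⟨?_, ?_, ?_, ?_⟩ <;> omega
        · simp only [rowTop, List.length_cons, List.length_nil]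
          split_ifs <;> omega
    · by_cases hr : x = k + 2 ∧ s = 1
      · refine (tau_rowCell_le
          [((x : ℤ) - 2, 1), ((x : ℤ) + 2, 1), ((x : ℤ) - 1, 0), ((x : ℤ) + 1, 0),
           ((x : ℤ) + 1, 2)] ?_).trans ?_
        · rintro d (rfl | rfl) <;>
          simp only [IsRowCorner, List.mem_cons, List.not_mem_nil, Prod.ext_iff, or_false,
            and_true, true_and] <;>
          refine ⟨?_, ?_, ?_, ?_⟩ <;> omega
        · simp only [rowTop, List.length_cons, List.length_nil]
          split_ifs <;> omega
      · refine (tau_rowCell_le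
          [((x : ℤ) - 2, 1), ((x : ℤ) + 2, 1), ((x : ℤ) - 1, 0), ((x : ℤ) + 1, 0)] ?_).trans ?_
        · rintro d (rfl | rfl) <;>
          simp only [IsRowCorner, List.mem_cons, List.not_mem_nil, Prod.ext_iff, or_false,
            and_true, true_and] <;>
          refine ⟨?_, ?_, ?_, ?_⟩ <;> omega
        · simp only [rowTop, List.length_cons, List.length_nil]
          split_ifs <;> omega

theorem tau_rowBot_le {k x : ℕ} {s : ℤ} (hs : s = 1 ∨ s = -1) (hx : x < k + 5) :
    tau (k + 6) (rowCell k s) ((x : ℤ), 0) ≤ rowBot k s x := by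
  obtain rfl | rfl | rfl | rfl | h : x = 0 ∨ x = 1 ∨ x = k + 3 ∨ x = k + 4 ∨
      (2 ≤ x ∧ x ≤ k + 2) := by omega
  · refine (tau_rowCell_le [(2, 0), (1, 1), (0, 2)] ?_).trans ?_
    · rintro d (rfl | rfl) <;>
      simp only [IsRowCorner, List.mem_cons, List.not_mem_nil, Prod.ext_iff, or_false,
        and_true, true_and] <;>
      refine ⟨?_, ?_, ?_, ?_⟩ <;> omega
    · simp only [rowBot, List.length_cons, List.length_nil]
      split_ifs <;> omega
  · refine (tau_rowCell_le [(3, 0), (0, 1), (2, 1), (1, 2)] ?_).trans ?_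
    · rintro d (rfl | rfl) <;>
      simp only [IsRowCorner, List.mem_cons, List.not_mem_nil, Prod.ext_iff, or_false,
        and_true, true_and] <;>
      refine ⟨?_, ?_, ?_, ?_⟩ <;> omega
    · simp only [rowBot, List.length_cons, List.length_nil]
      split_ifs <;> first | omega | simp_all
  · rcases hs with rfl | rfl
    · refine (tau_rowCell_le
        [((k : ℤ) + 1, 0), ((k : ℤ) + 2, 1), ((k : ℤ) + 4, 1), ((k : ℤ) + 3, 2)] ?_).trans ?_
      · rintro d (rfl | rfl) <;>
        simp only [IsRowCorner, List.mem_cons, List.not_mem_nil, Prod.ext_iff, or_false,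
          and_true, true_and] <;>
        refine ⟨?_, ?_, ?_, ?_⟩ <;> omega
      · simp only [rowBot, List.length_cons, List.length_nil]
        split_ifs <;> first | omega | simp_all
    · refine (tau_rowCell_le
        [((k : ℤ) + 1, 0), ((k : ℤ) + 2, 1), ((k : ℤ) + 4, 1), ((k : ℤ) + 4, -1)] ?_).trans ?_
      · rintro d (rfl | rfl) <;>
        simp only [IsRowCorner, List.mem_cons, List.not_mem_nil, Prod.ext_iff, or_false,
          and_true, true_and] <;>
        refine ⟨?_, ?_, ?_, ?_⟩ <;> omega
      · simp only [rowBot, List.length_cons, List.length_nil]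
        split_ifs <;> first | omega | simp_all
  · rcases hs with rfl | rfl
    · refine (tau_rowCell_le [((k : ℤ) + 2, 0), ((k : ℤ) + 3, 1), ((k : ℤ) + 4, 2)] ?_).trans ?_
      · rintro d (rfl | rfl) <;>
        simp only [IsRowCorner, List.mem_cons, List.not_mem_nil, Prod.ext_iff, or_false,
          and_true, true_and] <;>
        refine ⟨?_, ?_, ?_, ?_⟩ <;> omega
      · simp only [rowBot, List.length_cons, List.length_nil]
        split_ifs <;> omega
    · refine (tau_rowCell_le [((k : ℤ) + 2, 0), ((k : ℤ) + 3, 1), ((k : ℤ) + 3, -1)] ?_).trans ?_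
      · rintro d (rfl | rfl) <;>
        simp only [IsRowCorner, List.mem_cons, List.not_mem_nil, Prod.ext_iff, or_false,
          and_true, true_and] <;>
        refine ⟨?_, ?_, ?_, ?_⟩ <;> omega
      · simp only [rowBot, List.length_cons, List.length_nil]
        split_ifs <;> omega
  · by_cases hr : x = k + 2 ∧ s = -1
    · refine (tau_rowCell_le
        [((x : ℤ) - 2, 0), ((x : ℤ) + 2, 0), ((x : ℤ) - 1, 1), ((x : ℤ) + 1, 1),
         ((x : ℤ) + 1, -1)] ?_).trans ?_
      · rintro d (rfl | rfl) <;>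
        simp only [IsRowCorner, List.mem_cons, List.not_mem_nil, Prod.ext_iff, or_false,
          and_true, true_and] <;>
        refine ⟨?_, ?_, ?_, ?_⟩ <;> omega
      · simp only [rowBot, List.length_cons, List.length_nil]
        split_ifs <;> omega
    · refine (tau_rowCell_le
        [((x : ℤ) - 2, 0), ((x : ℤ) + 2, 0), ((x : ℤ) - 1, 1), ((x : ℤ) + 1, 1)] ?_).trans ?_
      · rintro d (rfl | rfl) <;>
        simp only [IsRowCorner, List.mem_cons, List.not_mem_nil, Prod.ext_iff, or_false,
          and_true, true_and] <;>
        refine ⟨?_, ?_, ?_, ?_⟩ <;> omega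
      · simp only [rowBot, List.length_cons, List.length_nil]
        split_ifs <;> omega

theorem tau_rowCell_ends_le (k : ℕ) {s : ℤ} (hs : s = 1 ∨ s = -1) :
    tau (k + 6) (rowCell k s) (0, 2) ≤ 2 ∧ tau (k + 6) (rowCell k s) (1, 2) ≤ 3 ∧
    tau (k + 6) (rowCell k s) ((k : ℤ) + 4, (3 * s + 1) / 2) ≤ 2 ∧
    tau (k + 6) (rowCell k s) ((k : ℤ) + 3, (3 * s + 1) / 2) ≤ 3 := by
  refine ⟨tau_rowCell_le [(1, 1), (0, 0)] ?_, tau_rowCell_le [(0, 1), (2, 1), (1, 0)] ?_, ?_, ?_⟩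
  · rintro d (rfl | rfl) <;>
      simp only [IsRowCorner, List.mem_cons, List.not_mem_nil, Prod.ext_iff, or_false,
        and_true, true_and] <;>
      refine ⟨?_, ?_, ?_, ?_⟩ <;> omega
  · rintro d (rfl | rfl) <;>
      simp only [IsRowCorner, List.mem_cons, List.not_mem_nil, Prod.ext_iff, or_false,
        and_true, true_and] <;>
      refine ⟨?_, ?_, ?_, ?_⟩ <;> omega
  · refine tau_rowCell_le [((k : ℤ) + 3, (s + 1) / 2), ((k : ℤ) + 4, (1 - s) / 2)] ?_
    rcases hs with rfl | rfl <;> rintro d (rfl | rfl) <;>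
      simp only [IsRowCorner, List.mem_cons, List.not_mem_nil, Prod.ext_iff, or_false,
        and_true, true_and] <;>
      refine ⟨?_, ?_, ?_, ?_⟩ <;> omega
  · refine tau_rowCell_le
      [((k : ℤ) + 2, (s + 1) / 2), ((k : ℤ) + 4, (s + 1) / 2), ((k : ℤ) + 3, (1 - s) / 2)] ?_
    rcases hs with rfl | rfl <;> rintro d (rfl | rfl) <;>
      simp only [IsRowCorner, List.mem_cons, List.not_mem_nil, Prod.ext_iff, or_false,
        and_true, true_and] <;>
      refine ⟨?_, ?_, ?_, ?_⟩ <;> omega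

theorem ZC1_rowCell_le_sum (k : ℕ) {s : ℤ} (hs : s = 1 ∨ s = -1) :
    ZC1 (k + 6) (rowCell k s) ≤ ∑ x ∈ Finset.range (k + 5), rowTop k s x ^ 2 +
      ∑ x ∈ Finset.range (k + 5), rowBot k s x ^ 2 + 26 := by
  obtain ⟨h₁, h₂, h₃, h₄⟩ := tau_rowCell_ends_le k hs
  refine (sum_le_list_sum (l := (List.range (k + 5)).map (fun x : ℕ => ((x : ℤ), (1 : ℤ))) ++
    (List.range (k + 5)).map (fun x : ℕ => ((x : ℤ), (0 : ℤ))) ++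
    [(0, 2), (1, 2), ((k : ℤ) + 4, (3 * s + 1) / 2), ((k : ℤ) + 3, (3 * s + 1) / 2)]) _ ?_).trans ?_
  · rintro ⟨a, b⟩ h
    obtain ⟨i, hi, h⟩ := mem_corners_iff.1 h
    have h := IsRowCorner.of_isSquareCorner hi h
    simp only [List.mem_append, List.mem_map, List.mem_range, List.mem_cons, List.not_mem_nil,
      Prod.ext_iff, or_false]
    unfold IsRowCorner at h
    by_cases h1 : 0 ≤ b ∧ b ≤ 1
    · left
      by_cases hb : b = 1
      · exact .inl ⟨a.toNat, by omega, by omega, by omega⟩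
      · exact .inr ⟨a.toNat, by omega, by omega, by omega⟩
    · right
      rcases hs with rfl | rfl <;> omega
  · simp only [List.map_append, List.map_map, List.sum_append, List.map_cons, List.map_nil,
      List.sum_cons, List.sum_nil, list_range_map_sum, Function.comp_apply]
    have hr := fun x (hx : x ∈ Finset.range (k + 5)) =>
      Nat.pow_le_pow_left (tau_rowTop_le hs (Finset.mem_range.1 hx)) 2
    have hr' := fun x (hx : x ∈ Finset.range (k + 5)) =>
      Nat.pow_le_pow_left (tau_rowBot_le hs (Finset.mem_range.1 hx)) 2
    have := Finset.sum_le_sum hr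
    have := Finset.sum_le_sum hr'
    have := Nat.pow_le_pow_left h₁ 2
    have := Nat.pow_le_pow_left h₂ 2
    have := Nat.pow_le_pow_left h₃ 2
    have := Nat.pow_le_pow_left h₄ 2
    omega

theorem rowCell_sums (k : ℕ) {s : ℤ} (hs : s = 1 ∨ s = -1) :
    ∑ x ∈ Finset.range (k + 5), rowTop k s x ^ 2 +
      ∑ x ∈ Finset.range (k + 5), rowBot k s x ^ 2 + 26 ≤ 32 * k + 178 ∧
    ∑ x ∈ Finset.range (k + 4), rowTop k s x * rowTop k s (x + 1) +
        ∑ x ∈ Finset.range (k + 4), rowBot k s x * rowBot k s (x + 1) +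
        ∑ x ∈ Finset.range (k + 5), rowBot k s x * rowTop k s x + 48 ≤ 48 * k + 251 := by
  match k with
  | 0 => rcases hs with rfl | rfl <;> simp [Finset.sum_range_succ, rowTop, rowBot]
  | 1 => rcases hs with rfl | rfl <;> simp [Finset.sum_range_succ, rowTop, rowBot]
  | k + 2 =>
    rw [sum_range_eq_of_middle _ (k + 1) 16, sum_range_eq_of_middle _ (k + 1) 16,
      sum_range_eq_of_middle _ k 16, sum_range_eq_of_middle _ k 16,
      sum_range_eq_of_middle _ (k + 1) 16]
    · rcases hs with rfl | rfl <;> simp [rowTop, rowBot] <;> omega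
    all_goals
      intro x hx hx'
      simp only [rowTop, rowBot]
      repeat rw [if_neg (by omega)]
      try norm_num

/-- The undirected edges of the chain `rowCell k s`. -/
def rowEdges (k : ℕ) (s : ℤ) : List ((ℤ × ℤ) × (ℤ × ℤ)) :=
  (List.range (k + 4)).map (fun x : ℕ => (((x : ℤ), 1), (((x + 1 : ℕ) : ℤ), 1))) ++
  (List.range (k + 4)).map (fun x : ℕ => (((x : ℤ), 0), (((x + 1 : ℕ) : ℤ), 0))) ++
  (List.range (k + 5)).map (fun x : ℕ => (((x : ℤ), 0), ((x : ℤ), 1))) ++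
  [((((0 : ℕ) : ℤ), 1), (0, 2)), ((((1 : ℕ) : ℤ), 1), (1, 2)), ((0, 2), (1, 2)),
    ((((k + 3 : ℕ) : ℤ), (s + 1) / 2), ((k : ℤ) + 3, (3 * s + 1) / 2)),
    ((((k + 4 : ℕ) : ℤ), (s + 1) / 2), ((k : ℤ) + 4, (3 * s + 1) / 2)),
    (((k : ℤ) + 3, (3 * s + 1) / 2), ((k : ℤ) + 4, (3 * s + 1) / 2))]

theorem mem_rowEdges_of_horizontal {k : ℕ} {s x y : ℤ} (hs : s = 1 ∨ s = -1)
    (hu : IsRowCorner k s (x, y)) (hv : IsRowCorner k s (x + 1, y)) :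
    ((x, y), (x + 1, y)) ∈ rowEdges k s := by
  simp only [rowEdges, List.mem_append, List.mem_map, List.mem_range, List.mem_cons,
    List.not_mem_nil, Prod.ext_iff, or_false]
  unfold IsRowCorner at hu hv
  by_cases h1 : y = 1
  · exact .inl (.inl (.inl ⟨x.toNat, by omega, by omega, by omega⟩))
  by_cases h0 : y = 0
  · exact .inl (.inl (.inr ⟨x.toNat, by omega, by omega, by omega⟩))
  have key : (x = 0 ∧ y = 2) ∨ (x = k + 3 ∧ y = (3 * s + 1) / 2) := by
    rcases hs with rfl | rfl <;> omega
  rcases key with ⟨rfl, rfl⟩ | ⟨rfl, rfl⟩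
  · exact .inr (.inr (.inr (.inl ⟨⟨rfl, rfl⟩, rfl, rfl⟩)))
  · exact .inr (.inr (.inr (.inr (.inr (.inr ⟨⟨rfl, rfl⟩, by omega, rfl⟩)))))

theorem mem_rowEdges_of_vertical {k : ℕ} {s x y : ℤ} (hs : s = 1 ∨ s = -1)
    (hu : IsRowCorner k s (x, y)) (hv : IsRowCorner k s (x, y + 1)) :
    ((x, y), (x, y + 1)) ∈ rowEdges k s ∨ ((x, y + 1), (x, y)) ∈ rowEdges k s := by
  simp only [rowEdges, List.mem_append, List.mem_map, List.mem_range, List.mem_cons,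
    List.not_mem_nil, Prod.ext_iff, or_false]
  unfold IsRowCorner at hu hv
  by_cases h0 : y = 0
  · exact .inl (.inl (.inr ⟨x.toNat, by omega, by omega, by omega⟩))
  by_cases h1 : y = 1
  · left; right
    have key : x = 0 ∨ x = 1 ∨ s = 1 ∧ x = k + 3 ∨ s = 1 ∧ x = k + 4 := by
      rcases hs with rfl | rfl <;> omega
    rcases key with h | h | h | h
    · exact .inl (by omega)
    · exact .inr (.inl (by omega))
    · exact .inr (.inr (.inr (.inl (by omega))))
    · exact .inr (.inr (.inr (.inr (.inl (by omega)))))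
  · right; right
    have key : s = -1 ∧ y = -1 ∧ (x = k + 3 ∨ x = k + 4) := by
      rcases hs with rfl | rfl <;> omega
    rcases key with ⟨h, h', h'' | h''⟩
    · exact .inr (.inr (.inr (.inl (by omega))))
    · exact .inr (.inr (.inr (.inr (.inl (by omega)))))

theorem adjSum_rowCell_le_sum (k : ℕ) {s : ℤ} (hs : s = 1 ∨ s = -1) :
    adjSum (k + 6) (rowCell k s) ≤
      2 * (∑ x ∈ Finset.range (k + 4), rowTop k s x * rowTop k s (x + 1) +
        ∑ x ∈ Finset.range (k + 4), rowBot k s x * rowBot k s (x + 1) +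
        ∑ x ∈ Finset.range (k + 5), rowBot k s x * rowTop k s x + 48) := by
  obtain ⟨h₁, h₂, h₃, h₄⟩ := tau_rowCell_ends_le k hs
  refine (sum_le_list_sum (l := rowEdges k s ++ (rowEdges k s).map Prod.swap) _ ?_).trans ?_
  · rintro ⟨⟨x, y⟩, v⟩ h
    obtain ⟨ht, i, hi, hu, hv⟩ := chainGraph_adj_iff.1 (Finset.mem_filter.1 h).2
    have hu := IsRowCorner.of_isSquareCorner hi hu
    have hv := IsRowCorner.of_isSquareCorner hi hv
    obtain ⟨z, w⟩ := v
    have hswap : ∀ a b : ℤ × ℤ, (a, b) ∈ rowEdges k s ++ (rowEdges k s).map Prod.swap ↔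
        (a, b) ∈ rowEdges k s ∨ (b, a) ∈ rowEdges k s := by
      simp
    rw [hswap]
    obtain ⟨d, rfl | rfl, ⟨rfl, rfl⟩ | ⟨rfl, rfl⟩⟩ := taxicab_eq_one ht
    · exact .inl (mem_rowEdges_of_horizontal hs hu hv)
    · exact mem_rowEdges_of_vertical hs hu hv
    · right
      simpa using mem_rowEdges_of_horizontal hs hv (by simpa using hu)
    · simpa using (mem_rowEdges_of_vertical hs hv (by simpa using hu)).symm
  · have hcomm : (fun p : (ℤ × ℤ) × (ℤ × ℤ) => tau (k + 6) (rowCell k s) p.1 *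
        tau (k + 6) (rowCell k s) p.2) ∘ Prod.swap = fun p =>
        tau (k + 6) (rowCell k s) p.1 * tau (k + 6) (rowCell k s) p.2 :=
      funext fun p => mul_comm _ _
    rw [List.map_append, List.map_map, hcomm, List.sum_append, ← two_mul]
    refine Nat.mul_le_mul_left 2 ?_
    simp only [rowEdges, List.map_append, List.map_map, List.sum_append, List.map_cons,
      List.map_nil, List.sum_cons, List.sum_nil, list_range_map_sum, Function.comp_apply]
    have ht := fun x (hx : x < k + 5) => tau_rowTop_le hs hx
    have hb := fun x (hx : x < k + 5) => tau_rowBot_le hs hx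
    have hr : ∀ x ∈ Finset.range (k + 4), _ := fun x hx =>
      Nat.mul_le_mul (ht x (by have := Finset.mem_range.1 hx; omega))
        (ht (x + 1) (by have := Finset.mem_range.1 hx; omega))
    have hr' : ∀ x ∈ Finset.range (k + 4), _ := fun x hx =>
      Nat.mul_le_mul (hb x (by have := Finset.mem_range.1 hx; omega))
        (hb (x + 1) (by have := Finset.mem_range.1 hx; omega))
    have hv : ∀ x ∈ Finset.range (k + 5), _ := fun x hx =>
      Nat.mul_le_mul (hb x (Finset.mem_range.1 hx)) (ht x (Finset.mem_range.1 hx))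
    have := Finset.sum_le_sum hr
    have := Finset.sum_le_sum hr'
    have := Finset.sum_le_sum hv
    have ht₀ : tau (k + 6) (rowCell k s) (((0 : ℕ) : ℤ), 1) ≤ 3 :=
      (ht 0 (by omega)).trans (by simp [rowTop])
    have ht₁ : tau (k + 6) (rowCell k s) (((1 : ℕ) : ℤ), 1) ≤ 4 :=
      (ht 1 (by omega)).trans (by simp [rowTop])
    have ht₃ : tau (k + 6) (rowCell k s) (((k + 3 : ℕ) : ℤ), (s + 1) / 2) ≤ 4 := by
      rcases hs with rfl | rfl
      · exact (ht (k + 3) (by omega)).trans (by simp [rowTop])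
      · exact (hb (k + 3) (by omega)).trans (by simp [rowBot])
    have ht₄ : tau (k + 6) (rowCell k s) (((k + 4 : ℕ) : ℤ), (s + 1) / 2) ≤ 3 := by
      rcases hs with rfl | rfl
      · exact (ht (k + 4) (by omega)).trans (by simp [rowTop])
      · exact (hb (k + 4) (by omega)).trans (by simp [rowBot])
    have := Nat.mul_le_mul ht₀ h₁
    have := Nat.mul_le_mul ht₁ h₂
    have := Nat.mul_le_mul h₁ h₂
    have := Nat.mul_le_mul ht₃ h₄
    have := Nat.mul_le_mul ht₄ h₃
    have := Nat.mul_le_mul h₄ h₃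
    omega

/-- The outer corner of the `j`-th cell of the zigzag `zigCell`, opposite to `zigCell (j + 1)`. -/
def zigOuter (j : ℕ) : ℤ × ℤ := (((j : ℤ) + 1) / 2 + (j : ℤ) % 2, (j : ℤ) / 2 + 1 - (j : ℤ) % 2)

/-- The two vertices past the right end of the zigzag part of `bentZigCell k`. -/
def zigTip (k : ℕ) : ℤ × ℤ := zigCell (k + 5) + (zigCell (k + 5) - zigCell (k + 4))

/-- The outer neighbour of `zigTip k`. -/
def zigOuterTip (k : ℕ) : ℤ × ℤ := zigOuter (k + 3) + (zigOuter (k + 3) - zigCell (k + 3))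

/-- The chain with links `1, 2^(k+2), 1`: a zigzag whose two end segments are prolonged by one
cell. -/
def bentZigCell (k i : ℕ) : ℤ × ℤ :=
  if i = 0 then (-1, 0)
  else if i = k + 5 then zigCell (k + 3) + (zigCell (k + 3) - zigCell (k + 2)) else zigCell (i - 1)

theorem bentZigCell_adj_cell {k j : ℕ} (hj : j < k + 4) {u v : ℤ × ℤ}
    (hu : IsSquareCorner (zigCell j) u) (hv : IsSquareCorner (zigCell j) v)
    (h : taxicab u v = 1) : (chainGraph (k + 6) (bentZigCell k)).Adj u v := by
  refine chainGraph_adj_iff.2 ⟨h, j + 1, by omega, ?_⟩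
  rw [bentZigCell, if_neg (by omega), if_neg (by omega)]
  exact ⟨hu, hv⟩

theorem bentZigCell_adj_succ {k i : ℕ} (hi : i < k + 5) :
    (chainGraph (k + 6) (bentZigCell k)).Adj (zigCell i) (zigCell (i + 1)) := by
  by_cases h : i < k + 4
  · refine bentZigCell_adj_cell h ?_ ?_ ?_ <;>
      simp only [IsSquareCorner, taxicab, zigCell, Prod.ext_iff, Prod.mk_add_mk,
      true_or, or_true, true_and, and_true] <;> omega
  · obtain rfl : i = k + 4 := by omega
    refine bentZigCell_adj_cell (j := k + 3) (by omega) ?_ ?_ ?_ <;>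
      simp only [IsSquareCorner, taxicab, zigCell, Prod.ext_iff, Prod.mk_add_mk,
      true_or, or_true, true_and, and_true] <;> omega

theorem bentZigCell_adj_outer {k j : ℕ} (hj : j < k + 4) :
    (chainGraph (k + 6) (bentZigCell k)).Adj (zigCell j) (zigOuter j) := by
  refine bentZigCell_adj_cell hj ?_ ?_ ?_ <;>
    simp only [IsSquareCorner, taxicab, zigCell, zigOuter, Prod.ext_iff, Prod.mk_add_mk,
      true_or, or_true, true_and, and_true] <;> omega

theorem bentZigCell_outer_adj {k j : ℕ} (hj : j < k + 4) :
    (chainGraph (k + 6) (bentZigCell k)).Adj (zigOuter j) (zigCell (j + 2)) := by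
  refine bentZigCell_adj_cell hj ?_ ?_ ?_ <;>
    simp only [IsSquareCorner, taxicab, zigCell, zigOuter, Prod.ext_iff, Prod.mk_add_mk,
      true_or, or_true, true_and, and_true] <;> omega

theorem bentZigCell_adj_left (k : ℕ) :
    (chainGraph (k + 6) (bentZigCell k)).Adj (-1, 0) (zigCell 0) ∧
    (chainGraph (k + 6) (bentZigCell k)).Adj (-1, 0) (-1, 1) ∧
    (chainGraph (k + 6) (bentZigCell k)).Adj (-1, 1) (zigOuter 0) := by
  refine ⟨chainGraph_adj_iff.2 ⟨?_, 0, ?_⟩, chainGraph_adj_iff.2 ⟨?_, 0, ?_⟩,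
    chainGraph_adj_iff.2 ⟨?_, 0, ?_⟩⟩ <;>
  simp [taxicab, IsSquareCorner, bentZigCell, zigCell, zigOuter]

theorem bentZigCell_adj_right (k : ℕ) :
    (chainGraph (k + 6) (bentZigCell k)).Adj (zigCell (k + 5)) (zigTip k) ∧
    (chainGraph (k + 6) (bentZigCell k)).Adj (zigOuterTip k) (zigTip k) ∧
    (chainGraph (k + 6) (bentZigCell k)).Adj (zigOuter (k + 3)) (zigOuterTip k) := by
  obtain ⟨m, hm⟩ := k.even_or_odd'
  have h5 : bentZigCell k (k + 5) = zigCell (k + 3) + (zigCell (k + 3) - zigCell (k + 2)) := by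
    simp [bentZigCell]
  refine ⟨chainGraph_adj_iff.2 ⟨?_, k + 5, by omega, ?_, ?_⟩,
    chainGraph_adj_iff.2 ⟨?_, k + 5, by omega, ?_, ?_⟩,
    chainGraph_adj_iff.2 ⟨?_, k + 5, by omega, ?_, ?_⟩⟩ <;>
  simp only [h5, IsSquareCorner, taxicab, zigCell, zigOuter, zigTip, zigOuterTip, Prod.ext_iff,
    Prod.fst_sub, Prod.snd_sub, Prod.fst_add, Prod.snd_add, true_or, or_true, true_and,
    and_true] <;> omega

/-- Lower bounds for the connection numbers along `zigCell`. -/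
def zigWeight (k i : ℕ) : ℕ :=
  if i = 0 ∨ i = k + 5 then 3 else if i = 1 ∨ i = k + 4 then 4 else 5

/-- Lower bounds for the connection numbers along `zigOuter`. -/
def zigOuterWeight (k j : ℕ) : ℕ :=
  if j = 0 ∨ j = 1 ∨ j = k + 2 ∨ j = k + 3 then 4 else 5

theorem zigWeight_le_tau {k i : ℕ} (hi : i < k + 6) :
    zigWeight k i ≤ tau (k + 6) (bentZigCell k) (zigCell i) := by
  have hP := fun i (hi : i < k + 5) => bentZigCell_adj_succ hi
  have hP' := fun i (hi : i < k + 5) => (bentZigCell_adj_succ hi).symm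
  have hQ := fun j (hj : j < k + 4) => bentZigCell_adj_outer hj
  have hQ' := fun j (hj : j < k + 4) => (bentZigCell_outer_adj hj).symm
  have hR := fun j (hj : j < k + 4) => bentZigCell_outer_adj hj
  obtain ⟨hE, hE', hE''⟩ := bentZigCell_adj_left k
  obtain ⟨hF, hF', hF''⟩ := bentZigCell_adj_right k
  have : i = 0 ∨ i = 1 ∨ i = 2 ∨ (∃ m < k, i = m + 3) ∨ i = k + 3 ∨ i = k + 4 ∨ i = k + 5 := by
    by_cases h : 3 ≤ i ∧ i < k + 3
    · exact .inr (.inr (.inr (.inl ⟨i - 3, by omega, by omega⟩)))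
    · omega
  obtain ⟨r, hr⟩ := k.even_or_odd'
  rcases this with rfl | rfl | rfl | ⟨m, hm, rfl⟩ | rfl | rfl | rfl
  · refine (le_of_eq ?_).trans (le_tau [(-1, 1), zigCell 2, zigOuter 1] ?_ ?_)
    · simp [zigWeight]
    · simp [zigCell, zigOuter]
    · simp only [List.forall_mem_cons]
      exact ⟨⟨by simp [zigCell], _, hE.symm, hE'⟩,
        ⟨by simp [zigCell], _, hP 0 (by omega), hP 1 (by omega)⟩,
        ⟨by simp [zigCell, zigOuter], _, hP 0 (by omega), hQ 1 (by omega)⟩, by simp⟩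
  · refine (le_of_eq ?_).trans (le_tau [(-1, 0), zigOuter 0, zigCell 3, zigOuter 2] ?_ ?_)
    · simp [zigWeight]
    · simp [zigCell, zigOuter]
    · simp only [List.forall_mem_cons]
      exact ⟨⟨by simp [zigCell], _, hP' 0 (by omega), hE.symm⟩,
        ⟨by simp [zigCell, zigOuter], _, hP' 0 (by omega), hQ 0 (by omega)⟩,
        ⟨by simp [zigCell], _, hP 1 (by omega), hP 2 (by omega)⟩,
        ⟨by simp [zigCell, zigOuter], _, hP 1 (by omega), hQ 2 (by omega)⟩, by simp⟩
  · refine (le_of_eq ?_).trans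
      (le_tau [zigCell 0, zigCell 4, zigOuter 1, (-1, 1), zigOuter 3] ?_ ?_)
    · simp [zigWeight]
    · simp [zigCell, zigOuter]
    · simp only [List.forall_mem_cons]
      exact ⟨⟨by simp [zigCell], _, hP' 1 (by omega), hP' 0 (by omega)⟩,
        ⟨by simp [zigCell], _, hP 2 (by omega), hP 3 (by omega)⟩,
        ⟨by simp [zigCell, zigOuter], _, hP' 1 (by omega), hQ 1 (by omega)⟩,
        ⟨by simp [zigCell], _, hQ' 0 (by omega), hE''.symm⟩,
        ⟨by simp [zigCell, zigOuter], _, hP 2 (by omega), hQ 3 (by omega)⟩, by simp⟩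
  · refine (le_of_eq ?_).trans (le_tau [zigCell (m + 1), zigCell (m + 5), zigOuter (m + 2),
      zigOuter m, zigOuter (m + 4)] ?_ ?_)
    · rw [zigWeight, if_neg (by omega), if_neg (by omega)]; rfl
    · simp [zigCell, zigOuter]; omega
    · simp only [List.forall_mem_cons]
      exact ⟨⟨by simp [zigCell]; omega, _, hP' (m + 2) (by omega), hP' (m + 1) (by omega)⟩,
        ⟨by simp [zigCell]; omega, _, hP (m + 3) (by omega), hP (m + 4) (by omega)⟩,
        ⟨by simp [zigCell, zigOuter]; omega, _, hP' (m + 2) (by omega), hQ (m + 2) (by omega)⟩,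
        ⟨by simp [zigCell, zigOuter]; omega, _, hP' (m + 2) (by omega), hR m (by omega) |>.symm⟩,
        ⟨by simp [zigCell, zigOuter]; omega, _, hP (m + 3) (by omega), hQ (m + 4) (by omega)⟩,
        by simp⟩
  · refine (le_of_eq ?_).trans (le_tau [zigCell (k + 1), zigCell (k + 5), zigOuter (k + 2),
      zigOuter k, zigOuterTip k] ?_ ?_)
    · simp [zigWeight]
    · simp [zigCell, zigOuter, zigOuterTip]; omega
    · simp only [List.forall_mem_cons]
      exact ⟨⟨by simp [zigCell]; omega, _, hP' (k + 2) (by omega), hP' (k + 1) (by omega)⟩,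
        ⟨by simp [zigCell]; omega, _, hP (k + 3) (by omega), hP (k + 4) (by omega)⟩,
        ⟨by simp [zigCell, zigOuter]; omega, _, hP' (k + 2) (by omega), hQ (k + 2) (by omega)⟩,
        ⟨by simp [zigCell, zigOuter]; omega, _, hP' (k + 2) (by omega), hQ' k (by omega)⟩,
        ⟨by simp [zigCell, zigOuter, zigOuterTip]; omega, _, hQ (k + 3) (by omega), hF''⟩,
        by simp⟩
  · refine (le_of_eq ?_).trans (le_tau [zigCell (k + 2), zigTip k, zigOuter (k + 3),
      zigOuter (k + 1)] ?_ ?_)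
    · simp [zigWeight]
    · simp [zigCell, zigOuter, zigTip]; omega
    · simp only [List.forall_mem_cons]
      exact ⟨⟨by simp [zigCell]; omega, _, hP' (k + 3) (by omega), hP' (k + 2) (by omega)⟩,
        ⟨by simp [zigCell, zigTip]; omega, _, hP (k + 4) (by omega), hF⟩,
        ⟨by simp [zigCell, zigOuter]; omega, _, hP (k + 4) (by omega), hQ' (k + 3) (by omega)⟩,
        ⟨by simp [zigCell, zigOuter]; omega, _, hP' (k + 3) (by omega), hQ' (k + 1) (by omega)⟩,
        by simp⟩
  · refine (le_of_eq ?_).trans (le_tau [zigOuterTip k, zigCell (k + 3), zigOuter (k + 2)] ?_ ?_)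
    · simp [zigWeight]
    · simp [zigCell, zigOuter, zigOuterTip]; omega
    · simp only [List.forall_mem_cons]
      exact ⟨⟨by simp [zigCell, zigOuter, zigOuterTip]; omega, _, hF, hF'.symm⟩,
        ⟨by simp [zigCell]; omega, _, hP' (k + 4) (by omega), hP' (k + 3) (by omega)⟩,
        ⟨by simp [zigCell, zigOuter]; omega, _, hP' (k + 4) (by omega), hQ' (k + 2) (by omega)⟩,
        by simp⟩

theorem zigOuterWeight_le_tau {k j : ℕ} (hj : j < k + 4) :
    zigOuterWeight k j ≤ tau (k + 6) (bentZigCell k) (zigOuter j) := by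
  have hP := fun i (hi : i < k + 5) => bentZigCell_adj_succ hi
  have hP' := fun i (hi : i < k + 5) => (bentZigCell_adj_succ hi).symm
  have hQ := fun j (hj : j < k + 4) => bentZigCell_adj_outer hj
  have hQ' := fun j (hj : j < k + 4) => (bentZigCell_adj_outer hj).symm
  have hR := fun j (hj : j < k + 4) => bentZigCell_outer_adj hj
  have hR' := fun j (hj : j < k + 4) => (bentZigCell_outer_adj hj).symm
  obtain ⟨hE, hE', hE''⟩ := bentZigCell_adj_left k
  obtain ⟨hF, hF', hF''⟩ := bentZigCell_adj_right k
  have : j = 0 ∨ j = 1 ∨ (∃ m < k, j = m + 2) ∨ j = k + 2 ∨ j = k + 3 := by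
    by_cases h : 2 ≤ j ∧ j < k + 2
    · exact .inr (.inr (.inl ⟨j - 2, by omega, by omega⟩))
    · omega
  obtain ⟨r, hr⟩ := k.even_or_odd'
  rcases this with rfl | rfl | ⟨m, hm, rfl⟩ | rfl | rfl
  · refine (le_of_eq ?_).trans (le_tau [(-1, 0), zigCell 1, zigCell 3, zigOuter 2] ?_ ?_)
    · simp [zigOuterWeight]
    · simp [zigCell, zigOuter]
    · simp only [List.forall_mem_cons]
      exact ⟨⟨by simp [zigOuter], _, hE''.symm, hE'.symm⟩,
        ⟨by simp [zigCell, zigOuter], _, hQ' 0 (by omega), hP 0 (by omega)⟩,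
        ⟨by simp [zigCell, zigOuter], _, hR 0 (by omega), hP 2 (by omega)⟩,
        ⟨by simp [zigOuter], _, hR 0 (by omega), hQ 2 (by omega)⟩, by simp⟩
  · refine (le_of_eq ?_).trans (le_tau [zigCell 0, zigCell 2, zigCell 4, zigOuter 3] ?_ ?_)
    · simp [zigOuterWeight]
    · simp [zigCell, zigOuter]
    · simp only [List.forall_mem_cons]
      exact ⟨⟨by simp [zigCell, zigOuter], _, hQ' 1 (by omega), hP' 0 (by omega)⟩,
        ⟨by simp [zigCell, zigOuter], _, hQ' 1 (by omega), hP 1 (by omega)⟩,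
        ⟨by simp [zigCell, zigOuter], _, hR 1 (by omega), hP 3 (by omega)⟩,
        ⟨by simp [zigOuter], _, hR 1 (by omega), hQ 3 (by omega)⟩, by simp⟩
  · refine (le_of_eq ?_).trans (le_tau [zigCell (m + 1), zigCell (m + 3), zigCell (m + 5),
      zigOuter m, zigOuter (m + 4)] ?_ ?_)
    · rw [zigOuterWeight, if_neg (by omega)]; rfl
    · simp [zigCell, zigOuter]; omega
    · simp only [List.forall_mem_cons]
      exact ⟨
        ⟨by simp [zigCell, zigOuter]; omega, _, hQ' (m + 2) (by omega), hP' (m + 1) (by omega)⟩,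
        ⟨by simp [zigCell, zigOuter]; omega, _, hQ' (m + 2) (by omega), hP (m + 2) (by omega)⟩,
        ⟨by simp [zigCell, zigOuter]; omega, _, hR (m + 2) (by omega), hP (m + 4) (by omega)⟩,
        ⟨by simp [zigOuter]; omega, _, hQ' (m + 2) (by omega), hR' m (by omega)⟩,
        ⟨by simp [zigOuter]; omega, _, hR (m + 2) (by omega), hQ (m + 4) (by omega)⟩,
        by simp⟩
  · refine (le_of_eq ?_).trans (le_tau [zigCell (k + 1), zigCell (k + 3), zigCell (k + 5),
      zigOuter k] ?_ ?_)
    · simp [zigOuterWeight]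
    · simp [zigCell, zigOuter]; omega
    · simp only [List.forall_mem_cons]
      exact ⟨
        ⟨by simp [zigCell, zigOuter]; omega, _, hQ' (k + 2) (by omega), hP' (k + 1) (by omega)⟩,
        ⟨by simp [zigCell, zigOuter]; omega, _, hQ' (k + 2) (by omega), hP (k + 2) (by omega)⟩,
        ⟨by simp [zigCell, zigOuter]; omega, _, hR (k + 2) (by omega), hP (k + 4) (by omega)⟩,
        ⟨by simp [zigOuter]; omega, _, hQ' (k + 2) (by omega), hR' k (by omega)⟩, by simp⟩
  · refine (le_of_eq ?_).trans (le_tau [zigTip k, zigCell (k + 4), zigCell (k + 2),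
      zigOuter (k + 1)] ?_ ?_)
    · simp [zigOuterWeight]
    · simp [zigCell, zigOuter, zigTip]; omega
    · simp only [List.forall_mem_cons]
      exact ⟨⟨by simp [zigCell, zigOuter, zigTip]; omega, _, hF'', hF'⟩,
        ⟨by simp [zigCell, zigOuter]; omega, _, hR (k + 3) (by omega), hP' (k + 4) (by omega)⟩,
        ⟨by simp [zigCell, zigOuter]; omega, _, hQ' (k + 3) (by omega), hP' (k + 2) (by omega)⟩,
        ⟨by simp [zigOuter]; omega, _, hQ' (k + 3) (by omega), hR' (k + 1) (by omega)⟩, by simp⟩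

theorem two_le_tau_bentZigCell_ends (k : ℕ) :
    2 ≤ tau (k + 6) (bentZigCell k) (-1, 0) ∧ 2 ≤ tau (k + 6) (bentZigCell k) (-1, 1) ∧
    2 ≤ tau (k + 6) (bentZigCell k) (zigTip k) ∧
    2 ≤ tau (k + 6) (bentZigCell k) (zigOuterTip k) := by
  obtain ⟨hE, hE', hE''⟩ := bentZigCell_adj_left k
  obtain ⟨hF, hF', hF''⟩ := bentZigCell_adj_right k
  obtain ⟨r, hr⟩ := k.even_or_odd'
  refine ⟨le_tau [zigOuter 0, zigCell 1] ?_ ?_, le_tau [zigCell 0, zigCell 2] ?_ ?_,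
    le_tau [zigOuter (k + 3), zigCell (k + 4)] ?_ ?_,
    le_tau [zigCell (k + 5), zigCell (k + 3)] ?_ ?_⟩
  · simp [zigCell, zigOuter]
  · simp only [List.forall_mem_cons]
    exact ⟨⟨by simp [zigOuter], _, hE, bentZigCell_adj_outer (by omega)⟩,
      ⟨by simp [zigCell], _, hE, bentZigCell_adj_succ (by omega)⟩, by simp⟩
  · simp [zigCell]
  · simp only [List.forall_mem_cons]
    exact ⟨⟨by simp [zigCell], _, hE'.symm, hE⟩,
      ⟨by simp [zigCell], _, hE'', bentZigCell_outer_adj (by omega)⟩, by simp⟩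
  · simp [zigCell, zigOuter]; omega
  · simp only [List.forall_mem_cons]
    exact ⟨⟨by simp [zigCell, zigOuter, zigTip]; omega, _, hF.symm,
        (bentZigCell_outer_adj (j := k + 3) (by omega)).symm⟩,
      ⟨by simp [zigCell, zigTip]; omega, _, hF.symm,
        (bentZigCell_adj_succ (i := k + 4) (by omega)).symm⟩, by simp⟩
  · simp [zigCell]; omega
  · simp only [List.forall_mem_cons]
    exact ⟨⟨by simp [zigCell, zigOuter, zigOuterTip]; omega, _, hF', hF.symm⟩,
      ⟨by simp [zigCell, zigOuter, zigOuterTip]; omega, _, hF''.symm,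
        (bentZigCell_adj_outer (j := k + 3) (by omega)).symm⟩, by simp⟩

theorem zigWeight_sums (k : ℕ) :
    ∑ i ∈ Finset.range (k + 6), zigWeight k i ^ 2 +
      ∑ j ∈ Finset.range (k + 4), zigOuterWeight k j ^ 2 + 16 = 50 * k + 180 ∧
    ∑ i ∈ Finset.range (k + 5), zigWeight k i * zigWeight k (i + 1) +
      ∑ j ∈ Finset.range (k + 4), zigWeight k j * zigOuterWeight k j +
      ∑ j ∈ Finset.range (k + 4), zigOuterWeight k j * zigWeight k (j + 2) + 36 =
        75 * k + 261 := by
  match k with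
  | 0 => simp [Finset.sum_range_succ, zigWeight, zigOuterWeight]
  | 1 => simp [Finset.sum_range_succ, zigWeight, zigOuterWeight]
  | k + 2 =>
    rw [sum_range_eq_of_middle _ (k + 2) 25, sum_range_eq_of_middle _ k 25,
      sum_range_eq_of_middle _ (k + 1) 25, sum_range_eq_of_middle _ k 25,
      sum_range_eq_of_middle _ k 25]
    · simp [zigWeight, zigOuterWeight]; omega
    all_goals
      intro x hx hx'
      simp only [zigWeight, zigOuterWeight]
      repeat rw [if_neg (by omega)]
      try norm_num

theorem mem_corners_of_adj {n : ℕ} {c : ℕ → ℤ × ℤ} {u v : ℤ × ℤ}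
    (h : (chainGraph n c).Adj u v) : u ∈ corners n c ∧ v ∈ corners n c := by
  obtain ⟨-, i, hi, hu, hv⟩ := chainGraph_adj_iff.1 h
  exact ⟨mem_corners_iff.2 ⟨i, hi, hu⟩, mem_corners_iff.2 ⟨i, hi, hv⟩⟩

theorem zigCell_injective : Function.Injective zigCell := fun i j h => by
  simp only [zigCell, Prod.ext_iff] at h
  omega

theorem zigOuter_injective : Function.Injective zigOuter := fun i j h => by
  simp only [zigOuter, Prod.ext_iff] at h
  omega

theorem zigCell_ne_zigOuter (i j : ℕ) : zigCell i ≠ zigOuter j := fun h => by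
  simp only [zigCell, zigOuter, Prod.ext_iff] at h
  omega

/-- The four corners of the chain that are neither on `zigCell` nor on `zigOuter`. -/
def bentZigEnds (k : ℕ) : List (ℤ × ℤ) := [(-1, 0), (-1, 1), zigTip k, zigOuterTip k]

theorem bentZigEnds_nodup (k : ℕ) : (bentZigEnds k).Nodup := by
  obtain ⟨r, hr⟩ := k.even_or_odd'
  simp [bentZigEnds, zigTip, zigOuterTip, zigCell, zigOuter]
  omega

theorem zigCell_notMem_bentZigEnds {k i : ℕ} (hi : i < k + 6) : zigCell i ∉ bentZigEnds k := by
  obtain ⟨r, hr⟩ := k.even_or_odd'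
  simp [bentZigEnds, zigTip, zigOuterTip, zigCell, zigOuter]
  omega

theorem zigOuter_notMem_bentZigEnds {k j : ℕ} (hj : j < k + 4) :
    zigOuter j ∉ bentZigEnds k := by
  obtain ⟨r, hr⟩ := k.even_or_odd'
  simp [bentZigEnds, zigTip, zigOuterTip, zigCell, zigOuter]
  omega

theorem le_ZC1_bentZigCell (k : ℕ) :
    ∑ i ∈ Finset.range (k + 6), zigWeight k i ^ 2 +
      ∑ j ∈ Finset.range (k + 4), zigOuterWeight k j ^ 2 + 16 ≤ ZC1 (k + 6) (bentZigCell k) := by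
  obtain ⟨h₁, h₂, h₃, h₄⟩ := two_le_tau_bentZigCell_ends k
  refine le_trans ?_ (list_sum_le_sum (l := (List.range (k + 6)).map zigCell ++
    (List.range (k + 4)).map zigOuter ++ bentZigEnds k) _ ?_ ?_)
  · simp only [bentZigEnds, List.map_append, List.map_map, List.sum_append, List.map_cons,
      List.map_nil, List.sum_cons, List.sum_nil, list_range_map_sum, Function.comp_apply]
    have hr := fun i (hi : i ∈ Finset.range (k + 6)) =>
      Nat.pow_le_pow_left (zigWeight_le_tau (Finset.mem_range.1 hi)) 2
    have hr' := fun i (hi : i ∈ Finset.range (k + 4)) =>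
      Nat.pow_le_pow_left (zigOuterWeight_le_tau (Finset.mem_range.1 hi)) 2
    have := Finset.sum_le_sum hr
    have := Finset.sum_le_sum hr'
    have := Nat.pow_le_pow_left h₁ 2
    have := Nat.pow_le_pow_left h₂ 2
    have := Nat.pow_le_pow_left h₃ 2
    have := Nat.pow_le_pow_left h₄ 2
    omega
  · simp only [List.nodup_append, List.mem_append, List.mem_map, List.mem_range]
    refine ⟨⟨List.nodup_range.map zigCell_injective, List.nodup_range.map zigOuter_injective, ?_⟩,
      bentZigEnds_nodup k, ?_⟩
    · rintro _ ⟨i, -, rfl⟩ _ ⟨j, -, rfl⟩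
      exact zigCell_ne_zigOuter i j
    · rintro _ (⟨i, hi, rfl⟩ | ⟨i, hi, rfl⟩) b hb rfl
      exacts [zigCell_notMem_bentZigEnds hi hb, zigOuter_notMem_bentZigEnds hi hb]
  · simp only [List.mem_append, List.mem_map, List.mem_range, bentZigEnds, List.mem_cons,
      List.not_mem_nil, or_false]
    rintro _ ((⟨i, hi, rfl⟩ | ⟨i, hi, rfl⟩) | rfl | rfl | rfl | rfl)
    · by_cases h : i < k + 5
      · exact (mem_corners_of_adj (bentZigCell_adj_succ h)).1
      · obtain rfl : i = k + 4 + 1 := by omega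
        exact (mem_corners_of_adj (bentZigCell_adj_succ (by omega))).2
    · exact (mem_corners_of_adj (bentZigCell_adj_outer hi)).2
    · exact (mem_corners_of_adj (bentZigCell_adj_left k).1).1
    · exact (mem_corners_of_adj (bentZigCell_adj_left k).2.2).1
    · exact (mem_corners_of_adj (bentZigCell_adj_right k).1).2
    · exact (mem_corners_of_adj (bentZigCell_adj_right k).2.1).1

/-- The edges of the chain `bentZigCell k`, directed away from its left end. -/
def bentZigEdges (k : ℕ) : List ((ℤ × ℤ) × (ℤ × ℤ)) :=
  (List.range (k + 5)).map (fun i => (zigCell i, zigCell (i + 1))) ++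
  (List.range (k + 4)).map (fun j => (zigCell j, zigOuter j)) ++
  (List.range (k + 4)).map (fun j => (zigOuter j, zigCell (j + 2))) ++
  [((-1, 0), zigCell 0), ((-1, 0), (-1, 1)), ((-1, 1), zigOuter 0),
    (zigCell (k + 5), zigTip k), (zigOuterTip k, zigTip k), (zigOuter (k + 3), zigOuterTip k)]

theorem mem_bentZigEdges_iff {k : ℕ} {p : (ℤ × ℤ) × (ℤ × ℤ)} : p ∈ bentZigEdges k ↔
    (((∃ i < k + 5, (zigCell i, zigCell (i + 1)) = p) ∨
      ∃ j < k + 4, (zigCell j, zigOuter j) = p) ∨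
      ∃ j < k + 4, (zigOuter j, zigCell (j + 2)) = p) ∨
    p ∈ [((-1, 0), zigCell 0), ((-1, 0), (-1, 1)), ((-1, 1), zigOuter 0),
      (zigCell (k + 5), zigTip k), (zigOuterTip k, zigTip k),
      (zigOuter (k + 3), zigOuterTip k)] := by
  simp only [bentZigEdges, List.mem_append, List.mem_map, List.mem_range]

theorem adj_of_mem_bentZigEdges {k : ℕ} {p : (ℤ × ℤ) × (ℤ × ℤ)} (hp : p ∈ bentZigEdges k) :
    (chainGraph (k + 6) (bentZigCell k)).Adj p.1 p.2 := by
  obtain ⟨hE, hE', hE''⟩ := bentZigCell_adj_left k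
  obtain ⟨hF, hF', hF''⟩ := bentZigCell_adj_right k
  simp only [mem_bentZigEdges_iff, List.mem_cons, List.not_mem_nil, or_false] at hp
  rcases hp with ((⟨i, hi, rfl⟩ | ⟨i, hi, rfl⟩) | ⟨i, hi, rfl⟩) | rfl | rfl | rfl | rfl | rfl | rfl
  exacts [bentZigCell_adj_succ hi, bentZigCell_adj_outer hi, bentZigCell_outer_adj hi, hE, hE',
    hE'', hF, hF', hF'']

theorem height_lt_of_mem_bentZigEdges {k : ℕ} {p : (ℤ × ℤ) × (ℤ × ℤ)}
    (hp : p ∈ bentZigEdges k) : p.1.1 + p.1.2 < p.2.1 + p.2.2 := by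
  obtain ⟨r, hr⟩ := k.even_or_odd'
  simp only [mem_bentZigEdges_iff, List.mem_cons, List.not_mem_nil, or_false] at hp
  rcases hp with ((⟨i, hi, rfl⟩ | ⟨i, hi, rfl⟩) | ⟨i, hi, rfl⟩) |
      rfl | rfl | rfl | rfl | rfl | rfl <;>
    simp only [zigCell, zigOuter, zigTip, zigOuterTip, Prod.fst_add, Prod.snd_add, Prod.fst_sub,
      Prod.snd_sub] <;> omega

theorem bentZigEdges_nodup (k : ℕ) : (bentZigEdges k).Nodup := by
  simp only [bentZigEdges, List.nodup_append, List.mem_append, List.mem_map, List.mem_range]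
  refine ⟨⟨⟨List.nodup_range.map ?_, List.nodup_range.map ?_, ?_⟩, List.nodup_range.map ?_, ?_⟩,
    ?_, ?_⟩
  · exact fun i j h => zigCell_injective (Prod.ext_iff.1 h).1
  · exact fun i j h => zigCell_injective (Prod.ext_iff.1 h).1
  · rintro _ ⟨i, -, rfl⟩ _ ⟨j, -, rfl⟩ h
    exact zigCell_ne_zigOuter _ _ (Prod.ext_iff.1 h).2
  · exact fun i j h => zigOuter_injective (Prod.ext_iff.1 h).1
  · rintro _ (⟨i, -, rfl⟩ | ⟨i, -, rfl⟩) _ ⟨j, -, rfl⟩ h <;>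
      exact zigCell_ne_zigOuter _ _ (Prod.ext_iff.1 h).1
  · obtain ⟨r, hr⟩ := k.even_or_odd'
    simp [zigTip, zigOuterTip, zigCell, zigOuter]
    omega
  · have hends : ∀ p ∈ [((-1, 0), zigCell 0), ((-1, 0), (-1, 1)), ((-1, 1), zigOuter 0),
        (zigCell (k + 5), zigTip k), (zigOuterTip k, zigTip k),
        (zigOuter (k + 3), zigOuterTip k)], p.1 ∈ bentZigEnds k ∨ p.2 ∈ bentZigEnds k := by
      simp [bentZigEnds]
    rintro _ ((⟨i, hi, rfl⟩ | ⟨i, hi, rfl⟩) | ⟨i, hi, rfl⟩) p hp rfl <;>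
      rcases hends _ hp with h | h
    · exact zigCell_notMem_bentZigEnds (by omega) h
    · exact zigCell_notMem_bentZigEnds (by omega) h
    · exact zigCell_notMem_bentZigEnds (by omega) h
    · exact zigOuter_notMem_bentZigEnds hi h
    · exact zigOuter_notMem_bentZigEnds hi h
    · exact zigCell_notMem_bentZigEnds (by omega) h

theorem le_adjSum_bentZigCell (k : ℕ) :
    2 * (∑ i ∈ Finset.range (k + 5), zigWeight k i * zigWeight k (i + 1) +
      ∑ j ∈ Finset.range (k + 4), zigWeight k j * zigOuterWeight k j +
      ∑ j ∈ Finset.range (k + 4), zigOuterWeight k j * zigWeight k (j + 2) + 36) ≤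
        adjSum (k + 6) (bentZigCell k) := by
  obtain ⟨h₁, h₂, h₃, h₄⟩ := two_le_tau_bentZigCell_ends k
  refine le_trans ?_ (list_sum_le_sum
    (l := bentZigEdges k ++ (bentZigEdges k).map Prod.swap) _ ?_ ?_)
  · have hcomm : (fun p : (ℤ × ℤ) × (ℤ × ℤ) => tau (k + 6) (bentZigCell k) p.1 *
        tau (k + 6) (bentZigCell k) p.2) ∘ Prod.swap = fun p =>
        tau (k + 6) (bentZigCell k) p.1 * tau (k + 6) (bentZigCell k) p.2 :=
      funext fun p => mul_comm _ _
    rw [List.map_append, List.map_map, hcomm, List.sum_append, ← two_mul]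
    refine Nat.mul_le_mul_left 2 ?_
    simp only [bentZigEdges, List.map_append, List.map_map, List.sum_append, List.map_cons,
      List.map_nil, List.sum_cons, List.sum_nil, list_range_map_sum, Function.comp_apply]
    have hP := fun i (hi : i < k + 6) => zigWeight_le_tau hi
    have hQ := fun j (hj : j < k + 4) => zigOuterWeight_le_tau hj
    have := Finset.sum_le_sum fun x (hx : x ∈ Finset.range (k + 5)) =>
      have := Finset.mem_range.1 hx
      Nat.mul_le_mul (hP x (by omega)) (hP (x + 1) (by omega))
    have := Finset.sum_le_sum fun x (hx : x ∈ Finset.range (k + 4)) =>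
      have := Finset.mem_range.1 hx
      Nat.mul_le_mul (hP x (by omega)) (hQ x (by omega))
    have := Finset.sum_le_sum fun x (hx : x ∈ Finset.range (k + 4)) =>
      have := Finset.mem_range.1 hx
      Nat.mul_le_mul (hQ x (by omega)) (hP (x + 2) (by omega))
    have hP₀ : 3 ≤ tau (k + 6) (bentZigCell k) (zigCell 0) :=
      le_trans (by simp [zigWeight]) (hP 0 (by omega))
    have hP₁ : 3 ≤ tau (k + 6) (bentZigCell k) (zigCell (k + 5)) :=
      le_trans (by simp [zigWeight]) (hP (k + 5) (by omega))
    have hQ₀ : 4 ≤ tau (k + 6) (bentZigCell k) (zigOuter 0) :=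
      le_trans (by simp [zigOuterWeight]) (hQ 0 (by omega))
    have hQ₁ : 4 ≤ tau (k + 6) (bentZigCell k) (zigOuter (k + 3)) :=
      le_trans (by simp [zigOuterWeight]) (hQ (k + 3) (by omega))
    have := Nat.mul_le_mul h₁ hP₀
    have := Nat.mul_le_mul h₁ h₂
    have := Nat.mul_le_mul h₂ hQ₀
    have := Nat.mul_le_mul hP₁ h₃
    have := Nat.mul_le_mul h₄ h₃
    have := Nat.mul_le_mul hQ₁ h₄
    omega
  · refine List.nodup_append.2 ⟨bentZigEdges_nodup k,
      (bentZigEdges_nodup k).map Prod.swap_injective, ?_⟩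
    rintro _ hp _ hp' rfl
    obtain ⟨q, hq, rfl⟩ := List.mem_map.1 hp'
    exact lt_asymm (height_lt_of_mem_bentZigEdges hp) (height_lt_of_mem_bentZigEdges hq)
  · intro p hp
    have h : (chainGraph (k + 6) (bentZigCell k)).Adj p.1 p.2 := by
      rcases List.mem_append.1 hp with hp | hp
      · exact adj_of_mem_bentZigEdges hp
      · obtain ⟨q, hq, rfl⟩ := List.mem_map.1 hp
        exact (adj_of_mem_bentZigEdges hq).symm
    exact Finset.mem_filter.2 ⟨Finset.mem_product.2 (mem_corners_of_adj h), h⟩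

/-- `e` and `f` are perpendicular lattice unit vectors. -/
def IsFrame (e f : ℤ × ℤ) : Prop :=
  (e = (1, 0) ∨ e = (-1, 0)) ∧ (f = (0, 1) ∨ f = (0, -1)) ∨
    (e = (0, 1) ∨ e = (0, -1)) ∧ (f = (1, 0) ∨ f = (-1, 0))

theorem IsFrame.symm {e f : ℤ × ℤ} (h : IsFrame e f) : IsFrame f e := by
  unfold IsFrame at h ⊢
  tauto

theorem IsFrame.neg_left {e f : ℤ × ℤ} (h : IsFrame e f) : IsFrame (-e) f := by
  rcases h with ⟨rfl | rfl, h⟩ | ⟨rfl | rfl, h⟩ <;> simpa [IsFrame] using h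

theorem isFrame_of_ne {p q r : ℤ × ℤ} (hpq : taxicab p q = 1) (hqr : taxicab q r = 1)
    (hne : r ≠ p) (h : r - q ≠ q - p) : IsFrame (q - p) (r - q) := by
  obtain ⟨p₁, p₂⟩ := p
  obtain ⟨q₁, q₂⟩ := q
  obtain ⟨r₁, r₂⟩ := r
  obtain ⟨d, rfl | rfl, ⟨rfl, rfl⟩ | ⟨rfl, rfl⟩⟩ := taxicab_eq_one hpq <;>
    obtain ⟨d', rfl | rfl, ⟨rfl, rfl⟩ | ⟨rfl, rfl⟩⟩ := taxicab_eq_one hqr <;>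
    simp [IsFrame] at hne h ⊢

/-- Positioned chains that agree in some orthonormal frame have the same indices. -/
theorem ZC_eq_of_frame {n : ℕ} {c c' : ℕ → ℤ × ℤ} {o e f : ℤ × ℤ} (hef : IsFrame e f)
    (h : ∀ i < n, c' i = o + (c i).1 • e + (c i).2 • f) :
    ZC1 n c' = ZC1 n c ∧ ZC2 n c' = ZC2 n c := by
  let Φ : ℤ × ℤ ≃ ℤ × ℤ :=
    { toFun := fun v => (o.1 + (1 - e.1 - f.1) / 2 + v.1 * e.1 + v.2 * f.1,
        o.2 + (1 - e.2 - f.2) / 2 + v.1 * e.2 + v.2 * f.2)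
      invFun := fun v =>
        ((v.1 - o.1 - (1 - e.1 - f.1) / 2) * e.1 + (v.2 - o.2 - (1 - e.2 - f.2) / 2) * e.2,
          (v.1 - o.1 - (1 - e.1 - f.1) / 2) * f.1 + (v.2 - o.2 - (1 - e.2 - f.2) / 2) * f.2)
      left_inv := fun v => by
        rcases hef with ⟨rfl | rfl, rfl | rfl⟩ | ⟨rfl | rfl, rfl | rfl⟩ <;>
          simp only [Prod.ext_iff] <;> omega
      right_inv := fun v => by
        rcases hef with ⟨rfl | rfl, rfl | rfl⟩ | ⟨rfl | rfl, rfl | rfl⟩ <;>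
          simp only [Prod.ext_iff] <;> omega }
  refine ZC_congr Φ (fun u v => ?_) fun i hi v => ?_
  · rcases hef with ⟨rfl | rfl, rfl | rfl⟩ | ⟨rfl | rfl, rfl | rfl⟩ <;>
      simp only [Φ, Equiv.coe_fn_mk, taxicab] <;> omega
  · rw [h i hi]
    rcases hef with ⟨rfl | rfl, rfl | rfl⟩ | ⟨rfl | rfl, rfl | rfl⟩ <;>
      simp only [Φ, Equiv.coe_fn_mk, IsSquareCorner, Prod.ext_iff, Prod.fst_add, Prod.snd_add,
        Prod.smul_mk, smul_eq_mul] <;> omega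

/-- A turn followed by another turn restores the earlier direction. -/
theorem IsFrame.sub_eq_sub {p q r t : ℤ × ℤ} (h : IsFrame (q - p) (r - q))
    (hrt : taxicab r t = 1) (hpt : taxicab t p ≠ 1) (hqt : t ≠ q) (hne : t - r ≠ r - q) :
    t - r = q - p := by
  simp only [taxicab, ne_eq, IsFrame, Prod.ext_iff, Prod.fst_sub, Prod.snd_sub] at *
  omega

theorem link_add_three (c : ℕ → ℤ × ℤ) (i : ℕ) :
    link c (i + 3) = if c (i + 2) - c (i + 1) = c (i + 1) - c i then 1 else 2 := rfl

namespace IsPolyominoChain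

variable {n : ℕ} {c : ℕ → ℤ × ℤ}

theorem taxicab_succ (hc : IsPolyominoChain n c) {i : ℕ} (hi : i + 1 < n) :
    taxicab (c i) (c (i + 1)) = 1 :=
  (hc.2 i (i + 1) (by omega) hi).2 (.inr rfl)

theorem isFrame (hc : IsPolyominoChain n c) {i : ℕ} (hi : i + 2 < n)
    (h : link c (i + 3) = 2) : IsFrame (c (i + 1) - c i) (c (i + 2) - c (i + 1)) := by
  refine isFrame_of_ne (hc.taxicab_succ (by omega)) (hc.taxicab_succ hi) (fun e => ?_) fun e => ?_
  · have := hc.1 _ _ hi (by omega) e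
    omega
  · simp [link_add_three, e] at h

theorem sub_eq_sub (hc : IsPolyominoChain n c) {i : ℕ} (hi : i + 3 < n)
    (h : link c (i + 3) = 2) (h' : link c (i + 4) = 2) :
    c (i + 3) - c (i + 2) = c (i + 1) - c i := by
  refine (hc.isFrame (by omega) h).sub_eq_sub (hc.taxicab_succ hi) (fun e => ?_) (fun e => ?_)
    fun e => ?_
  · have := (hc.2 _ _ hi (by omega)).1 e
    omega
  · have := hc.1 _ _ hi (by omega) e
    omega
  · simp [link_add_three c (i + 1), e] at h'

end IsPolyominoChain

theorem sub_eq_sub_of_link {c : ℕ → ℤ × ℤ} {i : ℕ} (h : link c (i + 3) = 1) :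
    c (i + 2) - c (i + 1) = c (i + 1) - c i := by
  by_contra hne
  simp [link_add_three, hne] at h

theorem IsFrame.exists_smul_eq {e f g : ℤ × ℤ} (hf : IsFrame e f) (hg : IsFrame e g) :
    ∃ s : ℤ, (s = 1 ∨ s = -1) ∧ g = s • f := by
  have hfg : g = f ∨ g = -f := by
    rcases hf with ⟨rfl | rfl, rfl | rfl⟩ | ⟨rfl | rfl, rfl | rfl⟩ <;>
      simpa [IsFrame, or_comm] using hg
  rcases hfg with rfl | rfl
  · exact ⟨1, .inl rfl, (one_smul ℤ g).symm⟩
  · exact ⟨-1, .inr rfl, (neg_one_smul ℤ f).symm⟩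

/-- Every chain with links `1, 2^(k+2), 1` is congruent to `bentZigCell k`. -/
theorem ZC_eq_bentZigCell {k : ℕ} {c : ℕ → ℤ × ℤ} (hc : IsPolyominoChain (k + 6) c)
    (h₀ : link c 3 = 1) (h : ∀ i < k + 2, link c (i + 4) = 2) (h₁ : link c (k + 6) = 1) :
    ZC1 (k + 6) c = ZC1 (k + 6) (bentZigCell k) ∧
      ZC2 (k + 6) c = ZC2 (k + 6) (bentZigCell k) := by
  have hF : IsFrame (c 2 - c 1) (c 3 - c 2) := hc.isFrame (i := 1) (by omega) (h 0 (by omega))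
  have hS : ∀ j < k + 4, c (j + 1) = c 1 + (zigCell j).1 • (c 2 - c 1) +
      (zigCell j).2 • (c 3 - c 2) := by
    intro j
    induction j using Nat.strong_induction_on with
    | _ j ih =>
      intro hj
      match j with
      | 0 => simp [zigCell]
      | 1 => simp [zigCell]
      | 2 => simp [zigCell]
      | j + 3 =>
        have e := hc.sub_eq_sub (i := j + 1) (by omega) (h j (by omega)) (h (j + 1) (by omega))
        have e₀ := ih j (by omega) (by omega)
        have e₁ := ih (j + 1) (by omega) (by omega)
        have e₂ := ih (j + 2) (by omega) (by omega)
        rw [show c (j + 3 + 1) = c (j + 2 + 1) + (c (j + 1 + 1) - c (j + 1)) by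
          rw [← e]; abel, e₀, e₁, e₂]
        generalize c 2 - c 1 = e, c 3 - c 2 = f
        have h₁ : (zigCell (j + 3)).1 = (zigCell (j + 2)).1 + ((zigCell (j + 1)).1 -
            (zigCell j).1) := by simp only [zigCell]; omega
        have h₂ : (zigCell (j + 3)).2 = (zigCell (j + 2)).2 + ((zigCell (j + 1)).2 -
            (zigCell j).2) := by simp only [zigCell]; omega
        rw [h₁, h₂]
        module
  refine ZC_eq_of_frame (o := c 1) hF fun i hi => ?_
  unfold bentZigCell
  split_ifs with hi₀ hi₁
  · subst hi₀
    have := sub_eq_sub_of_link h₀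
    rw [zero_add] at this
    rw [this]
    simp
  · subst hi₁
    have := sub_eq_sub_of_link (i := k + 3) h₁
    rw [show c (k + 5) = c (k + 3 + 1) + (c (k + 3 + 1) - c (k + 2 + 1)) by
      rw [← this]; abel, hS (k + 3) (by omega), hS (k + 2) (by omega)]
    simp only [Prod.fst_add, Prod.snd_add, Prod.fst_sub, Prod.snd_sub]
    module
  · obtain ⟨j, rfl⟩ := Nat.exists_eq_add_of_le' (Nat.one_le_iff_ne_zero.2 hi₀)
    simpa using hS j (by omega)

/-- Every chain with links `2, 1^(k+2), 2` is congruent to `rowCell k 1` or `rowCell k (-1)`. -/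
theorem ZC_eq_rowCell {k : ℕ} {c : ℕ → ℤ × ℤ} (hc : IsPolyominoChain (k + 6) c)
    (h₀ : link c 3 = 2) (h : ∀ i < k + 2, link c (i + 4) = 1) (h₁ : link c (k + 6) = 2) :
    ∃ s : ℤ, (s = 1 ∨ s = -1) ∧ ZC1 (k + 6) c = ZC1 (k + 6) (rowCell k s) ∧
      ZC2 (k + 6) c = ZC2 (k + 6) (rowCell k s) := by
  have hF : IsFrame (c 2 - c 1) (c 0 - c 1) := by
    simpa using (hc.isFrame (i := 0) (by omega) h₀).neg_left.symm
  have hd : ∀ j < k + 3, c (j + 2) - c (j + 1) = c 2 - c 1 := by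
    intro j
    induction j with
    | zero => simp
    | succ j ih => exact fun hj => (sub_eq_sub_of_link (h j (by omega))).trans (ih (by omega))
  have hS : ∀ j < k + 4, c (j + 1) = c 1 + (j : ℤ) • (c 2 - c 1) := by
    intro j
    induction j with
    | zero => simp
    | succ j ih =>
      intro hj
      rw [← sub_add_cancel (c (j + 1 + 1)) (c (j + 1)), hd j (by omega), ih (by omega)]
      push_cast
      module
  have hF' : IsFrame (c 2 - c 1) (c (k + 5) - c (k + 4)) := by
    rw [← hd (k + 2) (by omega)]
    exact hc.isFrame (i := k + 3) (by omega) h₁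
  obtain ⟨s, hs, hs'⟩ := hF.exists_smul_eq hF'
  refine ⟨s, hs, ZC_eq_of_frame (o := c 1) hF fun i hi => ?_⟩
  unfold rowCell
  split_ifs with hi₀ hi₁
  · simp [hi₀]
  · subst hi₁
    rw [← sub_add_cancel (c (k + 5)) (c (k + 4)), hs', hS (k + 3) (by omega)]
    push_cast
    module
  · obtain ⟨j, rfl⟩ := Nat.exists_eq_add_of_le' (Nat.one_le_iff_ne_zero.2 hi₀)
    simpa using hS j (by omega)

/-- **Remark 2.11.** For `n ≥ 6` and both Zagreb connection indices:
`ZCi(PC(1,2^{n-4},1)) > ZCi(PC(2,1^{n-4},2))` for `i = 1, 2`. -/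
theorem ZC_compare_mixed_chains
    (n : ℕ) (hn : 6 ≤ n)
    (cA cB : ℕ → ℤ × ℤ)
    (hcA : IsPolyominoChain n cA) (hcB : IsPolyominoChain n cB)
    (hLA : HasLinks n cA fun k => if k = 3 ∨ k = n then 1 else 2)
    (hLB : HasLinks n cB fun k => if k = 3 ∨ k = n then 2 else 1) :
    ZC1 n cB < ZC1 n cA ∧ ZC2 n cB < ZC2 n cA := by
  obtain ⟨k, rfl⟩ := Nat.exists_eq_add_of_le' hn
  obtain ⟨hA₁, hA₂⟩ := ZC_eq_bentZigCell hcA ((hLA 3 le_rfl (by omega)).trans (if_pos (.inl rfl)))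
    (fun i hi => (hLA (i + 4) (by omega) (by omega)).trans (if_neg (by omega)))
    ((hLA (k + 6) (by omega) le_rfl).trans (if_pos (.inr rfl)))
  obtain ⟨s, hs, hB₁, hB₂⟩ :=
    ZC_eq_rowCell hcB ((hLB 3 le_rfl (by omega)).trans (if_pos (.inl rfl)))
      (fun i hi => (hLB (i + 4) (by omega) (by omega)).trans (if_neg (by omega)))
      ((hLB (k + 6) (by omega) le_rfl).trans (if_pos (.inr rfl)))
  rw [hA₁, hA₂, hB₁, hB₂, ZC2_eq_adjSum_div_two, ZC2_eq_adjSum_div_two]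
  have := ZC1_rowCell_le_sum k hs
  have := adjSum_rowCell_le_sum k hs
  have := rowCell_sums k hs
  have := le_ZC1_bentZigCell k
  have := le_adjSum_bentZigCell k
  have := zigWeight_sums k
  omega
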